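/- Define recursively the solution correspondence Σ* and conjectures φ* as follows: for length-1 economies, Σ*_1 is the set of stable matchings; for a continuation economy at history m^{t−1} and available agent k, φ*_t(m^{t−1},k) = {m̄ ∈ M_T(m^{t−1},k) : (m̄_s)_{s=t+1}^T ∈ Σ*_{T−t}(E_{t+1}^T(m̄^t))}, and Σ*_{T−t+1}(E_t^T(m^{t−1})) is the set of Φ*-solutions of that economy with respect to these conjectures. Then for every T ∈ ℕ and every length-T economy E^T, Σ*_T(E^T) is nonempty. -/

import Mathlib

/-!
A framework for two-sided, one-to-one, irreversible dynamic matching markets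
with conjectures, following Doval's "A framework for (dynamic) stability".

Periods are indexed `0, …, T-1` (the paper's periods `1, …, T`).
-/

namespace DynMatch

open Classical

noncomputable section

/-- A length-`T` two-sided dynamic economy: the arrivals on each side in each period. -/
structure Economy (A B : Type) where
  T : ℕ
  arrA : ℕ → Finset A
  arrB : ℕ → Finset B

/-- Validity of an economy: positive length, pairwise disjoint arrivals, and
no arrivals outside the horizon. -/
def Economy.Valid {A B : Type} (E : Economy A B) : Prop :=
  0 < E.T ∧
  (∀ s t, s ≠ t → Disjoint (E.arrA s) (E.arrA t)) ∧
  (∀ s t, s ≠ t → Disjoint (E.arrB s) (E.arrB t)) ∧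
  (∀ s, E.T ≤ s → E.arrA s = ∅) ∧ (∀ s, E.T ≤ s → E.arrB s = ∅)

/-- A raw dynamic matching: in every period, a partial pairing between the two sides
(`none` means unmatched, i.e. matched to oneself). -/
structure PreMatching (A B : Type) where
  mA : ℕ → A → Option B
  mB : ℕ → B → Option A

variable {A B : Type} [DecidableEq A] [DecidableEq B]

/-- Side-`A` agents having arrived up to (and including) period `t`. -/
def arrAUpTo (E : Economy A B) (t : ℕ) : Finset A := (Finset.range (t+1)).biUnion E.arrA

/-- Side-`B` agents having arrived up to (and including) period `t`. -/
def arrBUpTo (E : Economy A B) (t : ℕ) : Finset B := (Finset.range (t+1)).biUnion E.arrB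

/-- `m` is an irreversible dynamic matching for the economy `E`: in every period it is
an involutive pairing between arrived agents of the two sides, and once matched a
pair stays matched. -/
def IsMatching (E : Economy A B) (m : PreMatching A B) : Prop :=
  (∀ t a b, t < E.T → (m.mA t a = some b ↔ m.mB t b = some a)) ∧
  (∀ t a, t < E.T → m.mA t a ≠ none → a ∈ arrAUpTo E t) ∧
  (∀ t a b, t < E.T → m.mA t a = some b → b ∈ arrBUpTo E t) ∧
  (∀ t s a, t ≤ s → s < E.T → m.mA t a ≠ none → m.mA s a = m.mA t a) ∧
  (∀ t s b, t ≤ s → s < E.T → m.mB t b ≠ none → m.mB s b = m.mB t b)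

/-- The everywhere-unmatched prematching. -/
def emptyM : PreMatching A B := ⟨fun _ _ => none, fun _ _ => none⟩

/-- An agent of the economy: a side-`A` or a side-`B` agent. -/
abbrev Agent (A B : Type) := A ⊕ B

/-- `𝒜_t(m^{t-1})`: side-`A` agents available to match in period `t` given history `m`. -/
def availA (E : Economy A B) (m : PreMatching A B) (t : ℕ) : Finset A :=
  (arrAUpTo E t).filter fun a => ∀ s, s < t → m.mA s a = none

/-- `ℬ_t(m^{t-1})`: side-`B` agents available to match in period `t` given history `m`. -/
def availB (E : Economy A B) (m : PreMatching A B) (t : ℕ) : Finset B :=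
  (arrBUpTo E t).filter fun b => ∀ s, s < t → m.mB s b = none

/-- `k ∈ 𝒜_t(m^{t-1}) ∪ ℬ_t(m^{t-1})`. -/
def isAvail (E : Economy A B) (m : PreMatching A B) (t : ℕ) : Agent A B → Prop
  | Sum.inl a => a ∈ availA E m t
  | Sum.inr b => b ∈ availB E m t

/-- `k ∈ A_1 ∪ B_1`: `k` is a first-period arrival. -/
def inPeriodOne (E : Economy A B) : Agent A B → Prop
  | Sum.inl a => a ∈ E.arrA 0
  | Sum.inr b => b ∈ E.arrB 0

/-- `m_t(k) = k`: agent `k` is unmatched in period `t` under `m`. -/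
def unmatchedAt (m : PreMatching A B) (t : ℕ) : Agent A B → Prop
  | Sum.inl a => m.mA t a = none
  | Sum.inr b => m.mB t b = none

/-- `m` and `m'` agree in all periods `s < t` (i.e. they share the history `m^{t-1}`). -/
def agreeUpTo (m m' : PreMatching A B) (t : ℕ) : Prop :=
  ∀ s, s < t → (∀ a, m.mA s a = m'.mA s a) ∧ (∀ b, m.mB s b = m'.mB s b)

/-- Agent `k` is unmatched through period `t` (all periods `s ≤ t`) under `m`. -/
def unmatchedThrough (m : PreMatching A B) (t : ℕ) : Agent A B → Prop
  | Sum.inl a => ∀ s, s ≤ t → m.mA s a = none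
  | Sum.inr b => ∀ s, s ≤ t → m.mB s b = none

/-- `M_T(m^{t-1})`: matchings of `E` agreeing with `m` through period `t-1`. -/
def MSetH (E : Economy A B) (m : PreMatching A B) (t : ℕ) : Set (PreMatching A B) :=
  {m' | IsMatching E m' ∧ agreeUpTo m m' t}

/-- `M_T(m^{t-1}, k)`: matchings of `E` agreeing with `m` through period `t-1` and
leaving `k` unmatched through period `t`. -/
def MSet (E : Economy A B) (m : PreMatching A B) (t : ℕ) (k : Agent A B) :
    Set (PreMatching A B) :=
  {m' | IsMatching E m' ∧ agreeUpTo m m' t ∧ unmatchedThrough m' t k}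

/-- Preferences: Bernoulli utilities on both sides and discount factors.
(The payoff of remaining single is normalized to `0`.) -/
structure Pref (A B : Type) where
  u : A → B → ℝ
  v : A → B → ℝ
  dA : A → ℝ
  dB : B → ℝ

/-- Discount factors lie in `[0,1]`. -/
def Pref.Valid (P : Pref A B) : Prop :=
  (∀ a, 0 ≤ P.dA a ∧ P.dA a ≤ 1) ∧ (∀ b, 0 ≤ P.dB b ∧ P.dB b ≤ 1)

/-- `t_m(a)`: the first period `s ≥ t` at which `a` is matched under `m` (`T` if never). -/
def matchTimeA (E : Economy A B) (m : PreMatching A B) (t : ℕ) (a : A) : ℕ :=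
  min (sInf {s | t ≤ s ∧ m.mA s a ≠ none}) E.T

/-- `t_m(b)`: the first period `s ≥ t` at which `b` is matched under `m` (`T` if never). -/
def matchTimeB (E : Economy A B) (m : PreMatching A B) (t : ℕ) (b : B) : ℕ :=
  min (sInf {s | t ≤ s ∧ m.mB s b ≠ none}) E.T

/-- `U_t(a,m) = δ_a^{t_m(a)-t}·u(a, m_T(a))` (and `0` if `a` ends up unmatched). -/
def Upay (P : Pref A B) (E : Economy A B) (m : PreMatching A B) (t : ℕ) (a : A) : ℝ :=
  match m.mA (E.T - 1) a with
  | none => 0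
  | some b => P.dA a ^ (matchTimeA E m t a - t) * P.u a b

/-- `V_t(b,m) = δ_b^{t_m(b)-t}·v(m_T(b), b)` (and `0` if `b` ends up unmatched). -/
def Vpay (P : Pref A B) (E : Economy A B) (m : PreMatching A B) (t : ℕ) (b : B) : ℝ :=
  match m.mB (E.T - 1) b with
  | none => 0
  | some a => P.dB b ^ (matchTimeB E m t b - t) * P.v a b

/-- A family of conjectures `Φ`: for every period `t`, history `m^{t-1}` and agent `k`,
a set `φ_t(m^{t-1},k)` of matchings `k` considers possible upon remaining unmatched. -/
abbrev ConjFam (A B : Type) := ℕ → PreMatching A B → Agent A B → Set (PreMatching A B)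

/-- Validity of a family of conjectures for `E`: conjectures are (nonempty) subsets of
`M_T(m^{t-1},k)` and depend on the matching only through the history `m^{t-1}`. -/
def ConjFam.Valid (E : Economy A B) (φ : ConjFam A B) : Prop :=
  (∀ t m k, φ t m k ⊆ MSet E m t k) ∧
  (∀ t m m' k, agreeUpTo m m' t → φ t m k = φ t m' k) ∧
  (∀ t m k, t < E.T → IsMatching E m → isAvail E m t k → (φ t m k).Nonempty)

/-- `m` is a `Φ`-solution for `E` (Definition 3): in every period, every available agent
weakly prefers `m` to some conjectured matching, and no available pair blocks. -/
def IsSolution (P : Pref A B) (E : Economy A B) (φ : ConjFam A B)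
    (m : PreMatching A B) : Prop :=
  IsMatching E m ∧
  ∀ t, t < E.T →
    ((∀ a ∈ availA E m t, ∃ m' ∈ φ t m (Sum.inl a), Upay P E m' t a ≤ Upay P E m t a) ∧
     (∀ b ∈ availB E m t, ∃ m' ∈ φ t m (Sum.inr b), Vpay P E m' t b ≤ Vpay P E m t b) ∧
     (∀ a ∈ availA E m t, ∀ b ∈ availB E m t,
        ¬(P.u a b > Upay P E m t a ∧ P.v a b > Vpay P E m t b)))

/-- `Σ^Φ_T(E)`: the set of `Φ`-solutions of `E`. -/
def SolSet (P : Pref A B) (E : Economy A B) (φ : ConjFam A B) : Set (PreMatching A B) :=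
  {m | IsSolution P E φ m}

/-- The static (Gale–Shapley) notion of stability, for length-1 economies:
individual rationality plus absence of blocking pairs. -/
def Stable1 (P : Pref A B) (E : Economy A B) (m : PreMatching A B) : Prop :=
  IsMatching E m ∧
  (∀ a b, m.mA (E.T - 1) a = some b → 0 ≤ P.u a b) ∧
  (∀ b a, m.mB (E.T - 1) b = some a → 0 ≤ P.v a b) ∧
  (∀ a ∈ E.arrA 0, ∀ b ∈ E.arrB 0,
     ¬(P.u a b > Upay P E m 0 a ∧ P.v a b > Vpay P E m 0 b))

/-- The worst (minimal) period-`t` payoff of `a` over the set `C (inl a)` of matchings. -/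
def wA (P : Pref A B) (E : Economy A B) (t : ℕ)
    (C : Agent A B → Set (PreMatching A B)) (a : A) : ℝ :=
  sInf ((fun m' => Upay P E m' t a) '' C (Sum.inl a))

/-- The worst (minimal) period-`t` payoff of `b` over the set `C (inr b)` of matchings. -/
def wB (P : Pref A B) (E : Economy A B) (t : ℕ)
    (C : Agent A B → Set (PreMatching A B)) (b : B) : ℝ :=
  sInf ((fun m' => Vpay P E m' t b) '' C (Sum.inr b))

/-- Utility of side-`A` agent `a` in the induced one-period economy with outside
option value `W a` (truncated preferences). -/
def indU (P : Pref A B) (W : A → ℝ) (a : A) : Option B → ℝ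
  | none => W a
  | some b => P.u a b

/-- Utility of side-`B` agent `b` in the induced one-period economy with outside
option value `W b` (truncated preferences). -/
def indV (P : Pref A B) (W : B → ℝ) (b : B) : Option A → ℝ
  | none => W b
  | some a => P.v a b

/-- The period-`t` component of `mbar` is a stable matching of the one-period economy
`E_{t,φ}(m^{t-1})` induced by the conjecture profile `C` (Definition 6): matching among
the available agents, individually rational w.r.t. the worst-conjecture thresholds,
and without blocking pairs in the truncated preferences. -/
def StableInduced (P : Pref A B) (E : Economy A B) (m : PreMatching A B) (t : ℕ)
    (C : Agent A B → Set (PreMatching A B)) (mbar : PreMatching A B) : Prop :=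
  (∀ a ∈ availA E m t, ∀ b, mbar.mA t a = some b → b ∈ availB E m t ∧ mbar.mB t b = some a) ∧
  (∀ b ∈ availB E m t, ∀ a, mbar.mB t b = some a → a ∈ availA E m t ∧ mbar.mA t a = some b) ∧
  (∀ a ∈ availA E m t, ∀ b, mbar.mA t a = some b → wA P E t C a ≤ P.u a b) ∧
  (∀ b ∈ availB E m t, ∀ a, mbar.mB t b = some a → wB P E t C b ≤ P.v a b) ∧
  (∀ a ∈ availA E m t, ∀ b ∈ availB E m t,
     ¬(P.u a b > indU P (wA P E t C) a (mbar.mA t a) ∧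
       P.v a b > indV P (wB P E t C) b (mbar.mB t b)))

/-- `mbar_t` is stable among those who match in period `t` relative to the conjecture
profile `C` (Definition 7): every available agent matched in period `t` weakly prefers
its partner to its worst conjectured matching, and no pair of agents both matched in
period `t` blocks. -/
def StableAmongMatched (P : Pref A B) (E : Economy A B) (m : PreMatching A B) (t : ℕ)
    (C : Agent A B → Set (PreMatching A B)) (mbar : PreMatching A B) : Prop :=
  (∀ a ∈ availA E m t, ∀ b, mbar.mA t a = some b → wA P E t C a ≤ P.u a b) ∧
  (∀ b ∈ availB E m t, ∀ a, mbar.mB t b = some a → wB P E t C b ≤ P.v a b) ∧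
  (∀ a ∈ availA E m t, ∀ b ∈ availB E m t, ∀ b' a',
     mbar.mA t a = some b' → mbar.mB t b = some a' →
     ¬(P.u a b > P.u a b' ∧ P.v a b > P.v a' b))

/-- `E_t^T(m^{t-1})`: the continuation economy starting at period `t` given history `m`:
its first-period arrivals are the agents available at `t`, later arrivals are unchanged. -/
def contEconomy (E : Economy A B) (m : PreMatching A B) (t : ℕ) : Economy A B where
  T := E.T - t
  arrA := fun s => if s = 0 then availA E m t else E.arrA (t + s)
  arrB := fun s => if s = 0 then availB E m t else E.arrB (t + s)

/-- The restriction of `m` to the continuation economy starting in period `t`: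
time is shifted by `t` and agents matched strictly before `t` are dropped. -/
def restrictM (m : PreMatching A B) (t : ℕ) : PreMatching A B where
  mA := fun s a => if ∀ s', s' < t → m.mA s' a = none then m.mA (t + s) a else none
  mB := fun s b => if ∀ s', s' < t → m.mB s' b = none then m.mB (t + s) b else none

/-- The matching of the original economy corresponding to history `m` through period
`t-1` followed by the continuation matching `m'` (indexed from `0`) of the
continuation economy. -/
def splice (m m' : PreMatching A B) (t : ℕ) : PreMatching A B where
  mA := fun s a => if s < t then m.mA s a
    else if ∀ s', s' < t → m.mA s' a = none then m'.mA (s - t) a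
    else m.mA (t - 1) a
  mB := fun s b => if s < t then m.mB s b
    else if ∀ s', s' < t → m.mB s' b = none then m'.mB (s - t) b
    else m.mB (t - 1) b

/-- The family of conjectures that the family `φ` of the original economy induces on the
continuation economy `E_t^T(m^{t-1})`: at a continuation history, it is the (restriction
of the) original conjectures at the corresponding original history. -/
def contConj (E : Economy A B) (φ : ConjFam A B) (m : PreMatching A B) (t : ℕ) :
    ConjFam A B :=
  fun s mbar k => (fun m' => restrictM m' t) '' φ (t + s) (splice m mbar t) k

/-- The conjectures of eq. (2): the agent only rules out continuation matchings that do
not conform with the solution concept `S` from tomorrow onward. -/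
def starConj (S : Economy A B → Set (PreMatching A B)) (E : Economy A B) : ConjFam A B :=
  fun t m k =>
    {m' | m' ∈ MSet E m t k ∧ restrictM m' (t+1) ∈ S (contEconomy E m' (t+1))}

/-- `S` is the solution correspondence `Σ*` recursively generated by the conjectures of
eq. (2): stability for one-period economies, `Φ*`-solutions for longer economies
(empty continuations impose no restriction). -/
def IsStarFamily (P : Pref A B) (S : Economy A B → Set (PreMatching A B)) : Prop :=
  (∀ E : Economy A B, E.T = 0 → S E = Set.univ) ∧
  (∀ E : Economy A B, E.T = 1 → S E = {m | Stable1 P E m}) ∧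
  (∀ E : Economy A B, 2 ≤ E.T → S E = SolSet P E (starConj S E))

/-- The decreasing recursion defining the CVR conjectures at period `t`, history `m`,
relative to the continuation solution correspondence `DS`. -/
def cvrIter (P : Pref A B) (E : Economy A B)
    (DS : Economy A B → Set (PreMatching A B)) (t : ℕ) (m : PreMatching A B) :
    ℕ → Agent A B → Set (PreMatching A B)
  | 0 => fun k => MSet E m t k
  | n+1 => fun k =>
      {mbar | mbar ∈ MSet E m t k ∧
        StableAmongMatched P E m t (cvrIter P E DS t m n) mbar ∧
        restrictM mbar (t+1) ∈ DS (contEconomy E mbar (t+1))}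

/-- The CVR conjectures `φ_{D̂S,t}(m^{t-1},·)`: the limit (intersection) of the
decreasing recursion `cvrIter`. -/
def cvrConj (P : Pref A B) (DS : Economy A B → Set (PreMatching A B))
    (E : Economy A B) : ConjFam A B :=
  fun t m k => ⋂ n, cvrIter P E DS t m n k

/-- `DS` is the CVR-dynamic-stability correspondence `D̂S`: stable matchings for
one-period economies, `Φ_{D̂S}`-solutions for longer economies. -/
def IsCVRFamily (P : Pref A B) (DS : Economy A B → Set (PreMatching A B)) : Prop :=
  (∀ E : Economy A B, E.T = 0 → DS E = Set.univ) ∧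
  (∀ E : Economy A B, E.T = 1 → DS E = {m | Stable1 P E m}) ∧
  (∀ E : Economy A B, 2 ≤ E.T → DS E = SolSet P E (cvrConj P DS E))

/-- The dynamic-stability conjectures of Doval (2022): the period-`t` matching is stable
among those who match relative to individually rational continuation values, and the
continuation is dynamically stable. -/
def dsConj (P : Pref A B) (DSol : Economy A B → Set (PreMatching A B))
    (E : Economy A B) : ConjFam A B :=
  fun t m k =>
    {mbar | mbar ∈ MSet E m t k ∧
      (∀ a ∈ availA E m t, ∀ b, mbar.mA t a = some b → 0 ≤ P.u a b) ∧
      (∀ b ∈ availB E m t, ∀ a, mbar.mB t b = some a → 0 ≤ P.v a b) ∧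
      (∀ a ∈ availA E m t, ∀ b ∈ availB E m t, ∀ b' a',
         mbar.mA t a = some b' → mbar.mB t b = some a' →
         ¬(P.u a b > P.u a b' ∧ P.v a b > P.v a' b)) ∧
      restrictM mbar (t+1) ∈ DSol (contEconomy E mbar (t+1))}

/-- `DSol` is the dynamic-stability correspondence `DS` of Doval (2022). -/
def IsDSFamily (P : Pref A B) (DSol : Economy A B → Set (PreMatching A B)) : Prop :=
  (∀ E : Economy A B, E.T = 0 → DSol E = Set.univ) ∧
  (∀ E : Economy A B, E.T = 1 → DSol E = {m | Stable1 P E m}) ∧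
  (∀ E : Economy A B, 2 ≤ E.T → DSol E = SolSet P E (dsConj P DSol E))

/-- `E_{\k}`: the economy identical to `E` except that agent `k`'s arrival is delayed
by one period (from period `0` to period `1`). -/
def delayEconomy (E : Economy A B) : Agent A B → Economy A B
  | Sum.inl a =>
      { T := E.T
        arrA := fun s => if s = 0 then E.arrA 0 \ {a}
                 else if s = 1 then insert a (E.arrA 1) else E.arrA s
        arrB := E.arrB }
  | Sum.inr b =>
      { T := E.T
        arrA := E.arrA
        arrB := fun s => if s = 0 then E.arrB 0 \ {b}
                 else if s = 1 then insert b (E.arrB 1) else E.arrB s }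

/-- The candidate set `M*(m^{t-1}, C, Scont)`: matchings whose period-`t` matching is
stable in the one-period economy induced by the continuation-value sets `C`, and whose
continuation lies in `Scont` of the induced continuation economy. -/
def candT (P : Pref A B) (Scont : Economy A B → Set (PreMatching A B))
    (E : Economy A B) (t : ℕ) (m : PreMatching A B)
    (C : Agent A B → Set (PreMatching A B)) : Set (PreMatching A B) :=
  {mbar | mbar ∈ MSetH E m t ∧ StableInduced P E m t C mbar ∧
    restrictM mbar (t+1) ∈ Scont (contEconomy E mbar (t+1))}

/-- The increasing recursion `F_n` defining the sophisticated-dynamic-stability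
conjectures at period `t`, history `m`, relative to the correspondence `SDS` on
strictly shorter problems. -/
def sdsF (P : Pref A B) (SDS : Economy A B → Set (PreMatching A B))
    (E : Economy A B) (t : ℕ) (m : PreMatching A B) :
    ℕ → Agent A B → Set (PreMatching A B)
  | 0 => fun k =>
      {mbar | mbar ∈ MSet E m t k ∧
        restrictM mbar t ∈ SDS (delayEconomy (contEconomy E m t) k)}
  | n+1 => fun k => sdsF P SDS E t m n k ∪
      {mbar | mbar ∈ candT P SDS E t m (sdsF P SDS E t m n) ∧ unmatchedAt mbar t k}

/-- The SDS conjectures `φ_{SDS,t}`: the limit (union) of the increasing recursion `F_n`. -/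
def sdsConj (P : Pref A B) (SDS : Economy A B → Set (PreMatching A B))
    (E : Economy A B) : ConjFam A B :=
  fun t m k => ⋃ n, sdsF P SDS E t m n k

/-- `SDS` is the sophisticated-dynamic-stability correspondence. -/
def IsSDSFamily (P : Pref A B) (SDS : Economy A B → Set (PreMatching A B)) : Prop :=
  (∀ E : Economy A B, E.T = 0 → SDS E = Set.univ) ∧
  (∀ E : Economy A B, E.T = 1 → SDS E = {m | Stable1 P E m}) ∧
  (∀ E : Economy A B, 2 ≤ E.T → SDS E = SolSet P E (sdsConj P SDS E))

/-- The rational-expectations conjectures: `k` conjectures exactly the `RE` solutions of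
the continuation economy in which `k`'s arrival is delayed by one period. -/
def reConj (RE : Economy A B → Set (PreMatching A B)) (E : Economy A B) : ConjFam A B :=
  fun t m k =>
    {mbar | mbar ∈ MSet E m t k ∧
      restrictM mbar t ∈ RE (delayEconomy (contEconomy E m t) k)}

/-- `RE` is the rational-expectations solution correspondence. -/
def IsREFamily (P : Pref A B) (RE : Economy A B → Set (PreMatching A B)) : Prop :=
  (∀ E : Economy A B, E.T = 1 → RE E = {m | Stable1 P E m}) ∧
  (∀ E : Economy A B, 2 ≤ E.T → RE E = SolSet P E (reConj RE E))


set_option linter.unusedSectionVars false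

/-! ### Stable matchings in one-period markets with outside options -/

/-- The pair `(a, b)` blocks the pairing `M`, given outside options `α` and `β`. -/
def Blocks (u v : A → B → ℝ) (α : A → ℝ) (β : B → ℝ) (M : Finset (A × B)) (a : A) (b : B) :
    Prop :=
  α a < u a b ∧ β b < v a b ∧ (∀ b', (a, b') ∈ M → u a b' < u a b) ∧
    ∀ a', (a', b) ∈ M → v a' b < v a b

/-- `M` is an individually rational pairing between `X` and `Y`. -/
structure IsPairing (X : Finset A) (Y : Finset B) (u v : A → B → ℝ) (α : A → ℝ) (β : B → ℝ)
    (M : Finset (A × B)) : Prop where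
  subset : M ⊆ X ×ˢ Y
  right_unique : ∀ a b b', (a, b) ∈ M → (a, b') ∈ M → b = b'
  left_unique : ∀ a a' b, (a, b) ∈ M → (a', b) ∈ M → a = a'
  rational : ∀ a b, (a, b) ∈ M → α a ≤ u a b ∧ β b ≤ v a b

/-- Every finite one-period market with outside options has a stable pairing. The proof is
Sotomayor's: take a pairing that is best for side `B` among those in which only single
side-`A` agents take part in blocking pairs. -/
theorem exists_stable_pairing (X : Finset A) (Y : Finset B) (u v : A → B → ℝ)
    (α : A → ℝ) (β : B → ℝ) :
    ∃ M, IsPairing X Y u v α β M ∧ ∀ a ∈ X, ∀ b ∈ Y, ¬ Blocks u v α β M a b := by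
  let F := (X ×ˢ Y).powerset.filter fun M => IsPairing X Y u v α β M ∧
    ∀ a ∈ X, ∀ b ∈ Y, Blocks u v α β M a b → ∀ b', (a, b') ∉ M
  have hF : F.Nonempty := ⟨∅, by
    simp only [F, Finset.mem_filter]
    exact ⟨by simp, ⟨by simp, by simp, by simp, by simp⟩, by simp⟩⟩
  obtain ⟨M, hM, hmax⟩ := Finset.exists_max_image F
    (fun M => ∑ p ∈ M, (v p.1 p.2 - β p.2)) hF
  obtain ⟨hMp, hP, hsimple⟩ := Finset.mem_filter.1 hM
  refine ⟨M, hP, fun a ha b₀ hb₀ hblk₀ => ?_⟩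
  obtain ⟨b, hb, hbest⟩ := Finset.exists_max_image (Y.filter (Blocks u v α β M a)) (u a)
    ⟨b₀, Finset.mem_filter.2 ⟨hb₀, hblk₀⟩⟩
  obtain ⟨hbY, hblk⟩ := Finset.mem_filter.1 hb
  have hsingle := hsimple a ha b hbY hblk
  let M' := insert (a, b) (M.filter fun p => p.2 ≠ b)
  have memM' : ∀ x y, (x, y) ∈ M' ↔ (x = a ∧ y = b) ∨ ((x, y) ∈ M ∧ y ≠ b) := by
    intro x y
    simp [M']
  have hM' : M' ∈ F := by
    have hsub : M' ⊆ X ×ˢ Y := by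
      rintro ⟨x, y⟩ h
      rcases (memM' x y).1 h with ⟨rfl, rfl⟩ | ⟨h, -⟩
      · exact Finset.mem_product.2 ⟨ha, hbY⟩
      · exact hP.subset h
    refine Finset.mem_filter.2 ⟨Finset.mem_powerset.2 hsub, ⟨hsub, ?_, ?_, ?_⟩, ?_⟩
    · intro x y y' h h'
      rcases (memM' x y).1 h with ⟨h1, h2⟩ | ⟨h1, -⟩ <;>
      rcases (memM' x y').1 h' with ⟨h1', h2'⟩ | ⟨h1', -⟩
      · exact h2.trans h2'.symm
      · exact absurd (h1 ▸ h1') (hsingle y')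
      · exact absurd (h1' ▸ h1) (hsingle y)
      · exact hP.right_unique _ _ _ h1 h1'
    · intro x x' y h h'
      rcases (memM' x y).1 h with ⟨rfl, rfl⟩ | ⟨h, hy⟩ <;>
      rcases (memM' x' y).1 h' with ⟨h1, h2⟩ | ⟨h', hy'⟩
      · exact h1.symm
      · exact absurd rfl hy'
      · exact absurd h2 hy
      · exact hP.left_unique _ _ _ h h'
    · intro x y h
      rcases (memM' x y).1 h with ⟨rfl, rfl⟩ | ⟨h, -⟩
      · exact ⟨hblk.1.le, hblk.2.1.le⟩
      · exact hP.rational _ _ h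
    · intro x hx y hy hxy y' hmem
      have hyM : ∀ x', (x', y) ∈ M → v x' y < v x y := by
        intro x' hx'
        by_cases hyb : y = b
        · subst hyb
          exact (hblk.2.2.2 x' hx').trans (hxy.2.2.2 a ((memM' _ _).2 (Or.inl ⟨rfl, rfl⟩)))
        · exact hxy.2.2.2 x' ((memM' _ _).2 (Or.inr ⟨hx', hyb⟩))
      rcases (memM' x y').1 hmem with ⟨rfl, rfl⟩ | ⟨h, hy'⟩
      · have hlt := hxy.2.2.1 y' hmem
        have hold : Blocks u v α β M x y :=
          ⟨hxy.1, hxy.2.1, fun b' hb' => absurd hb' (hsingle b'), hyM⟩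
        exact absurd (hbest y (Finset.mem_filter.2 ⟨hy, hold⟩)) (not_le.2 hlt)
      · refine hsimple x hx y hy ⟨hxy.1, hxy.2.1, fun b' hb' => ?_, hyM⟩ y' h
        rw [hP.right_unique x b' y' hb' h]
        exact hxy.2.2.1 y' hmem
  have hold : ∑ p ∈ M.filter (fun p => ¬ p.2 ≠ b), (v p.1 p.2 - β p.2) < v a b - β b := by
    by_cases h : ∃ a', (a', b) ∈ M
    · obtain ⟨a', ha'⟩ := h
      have heq : M.filter (fun p => ¬ p.2 ≠ b) = {(a', b)} := by
        ext ⟨x, y⟩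
        simp only [ne_eq, not_not, Finset.mem_filter, Finset.mem_singleton, Prod.mk.injEq]
        constructor
        · rintro ⟨h, rfl⟩
          exact ⟨hP.left_unique _ _ _ h ha', rfl⟩
        · rintro ⟨rfl, rfl⟩
          exact ⟨ha', rfl⟩
      rw [heq, Finset.sum_singleton]
      linarith [hblk.2.2.2 a' ha']
    · have heq : M.filter (fun p => ¬ p.2 ≠ b) = ∅ := by
        refine Finset.filter_eq_empty_iff.2 ?_
        rintro ⟨x, y⟩ hp hy
        exact h ⟨x, not_not.1 hy ▸ hp⟩
      rw [heq, Finset.sum_empty]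
      linarith [hblk.2.1]
  have hnot : (a, b) ∉ M.filter fun p => p.2 ≠ b := by simp
  have hle := hmax M' hM'
  simp only [M', Finset.sum_insert hnot] at hle
  rw [← Finset.sum_filter_add_sum_filter_not M (fun p => p.2 ≠ b)] at hle
  linarith

/-- The prematching that pairs agents according to `M` in every period. -/
def ofPairs (M : Finset (A × B)) : PreMatching A B where
  mA := fun _ a => if h : ∃ b, (a, b) ∈ M then some h.choose else none
  mB := fun _ b => if h : ∃ a, (a, b) ∈ M then some h.choose else none

theorem ofPairs_mA_eq_some {M : Finset (A × B)}
    (hM : ∀ a b b', (a, b) ∈ M → (a, b') ∈ M → b = b') {t : ℕ} {a : A} {b : B} :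
    (ofPairs M).mA t a = some b ↔ (a, b) ∈ M := by
  by_cases h : ∃ b, (a, b) ∈ M
  · have := h.choose_spec
    simp only [ofPairs, dif_pos h, Option.some.injEq]
    exact ⟨fun e => e ▸ this, fun hb => hM _ _ _ this hb⟩
  · simp only [ofPairs, dif_neg h]
    exact ⟨fun e => by simp at e, fun hb => absurd ⟨b, hb⟩ h⟩

theorem ofPairs_mB_eq_some {M : Finset (A × B)}
    (hM : ∀ a a' b, (a, b) ∈ M → (a', b) ∈ M → a = a') {t : ℕ} {a : A} {b : B} :
    (ofPairs M).mB t b = some a ↔ (a, b) ∈ M := by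
  by_cases h : ∃ a, (a, b) ∈ M
  · have := h.choose_spec
    simp only [ofPairs, dif_pos h, Option.some.injEq]
    exact ⟨fun e => e ▸ this, fun hb => hM _ _ _ this hb⟩
  · simp only [ofPairs, dif_neg h]
    exact ⟨fun e => by simp at e, fun hb => absurd ⟨a, hb⟩ h⟩

/-! ### Exchanging the two sides -/

/-- The economy with the two sides exchanged. -/
def Economy.swap (E : Economy A B) : Economy B A := ⟨E.T, E.arrB, E.arrA⟩

/-- The prematching with the two sides exchanged. -/
def PreMatching.swap (m : PreMatching A B) : PreMatching B A := ⟨m.mB, m.mA⟩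

/-- The preferences with the two sides exchanged. -/
def Pref.swap (P : Pref A B) : Pref B A :=
  ⟨fun b a => P.v a b, fun b a => P.u a b, P.dB, P.dA⟩

theorem IsMatching.swap {E : Economy A B} {m : PreMatching A B} (h : IsMatching E m) :
    IsMatching E.swap m.swap := by
  obtain ⟨h1, h2, h3, h4, h5⟩ := h
  refine ⟨fun t b a ht => (h1 t a b ht).symm, fun t b ht hb => ?_, fun t b a ht hba => ?_, h5, h4⟩
  · obtain ⟨a, ha⟩ := Option.ne_none_iff_exists'.1 hb
    exact h3 t a b ht ((h1 t a b ht).2 ha)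
  · refine h2 t a ht ?_
    rw [(h1 t a b ht).2 hba]
    simp

theorem Vpay_eq_swap (P : Pref A B) (E : Economy A B) (m : PreMatching A B) (t : ℕ) (b : B) :
    Vpay P E m t b = Upay P.swap E.swap m.swap t b := rfl

/-! ### Payoffs -/

theorem Upay_eq_zero {P : Pref A B} {E : Economy A B} {m : PreMatching A B} {t : ℕ} {a : A}
    (h : m.mA (E.T - 1) a = none) : Upay P E m t a = 0 := by
  simp [Upay, h]

theorem Vpay_eq_zero {P : Pref A B} {E : Economy A B} {m : PreMatching A B} {t : ℕ} {b : B}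
    (h : m.mB (E.T - 1) b = none) : Vpay P E m t b = 0 :=
  Upay_eq_zero (P := P.swap) (E := E.swap) (m := m.swap) h

theorem Upay_of_matched {P : Pref A B} {E : Economy A B} {m : PreMatching A B} {t : ℕ}
    (hm : IsMatching E m) (ht : t < E.T) {a : A} {b : B} (h : m.mA t a = some b) :
    Upay P E m t a = P.u a b := by
  have hlast : m.mA (E.T - 1) a = some b := by
    rw [hm.2.2.2.1 t (E.T - 1) a (by omega) (by omega) (by simp [h]), h]
  have hle : matchTimeA E m t a ≤ t :=
    (min_le_left _ _).trans (Nat.sInf_le ⟨le_rfl, by simp [h]⟩)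
  simp [Upay, hlast, Nat.sub_eq_zero_of_le hle]

theorem Vpay_of_matched {P : Pref A B} {E : Economy A B} {m : PreMatching A B} {t : ℕ}
    (hm : IsMatching E m) (ht : t < E.T) {a : A} {b : B} (h : m.mB t b = some a) :
    Vpay P E m t b = P.v a b :=
  Upay_of_matched (P := P.swap) hm.swap ht h

theorem Upay_shift {P : Pref A B} {E E' : Economy A B} {m m' : PreMatching A B} {k t : ℕ} {a : A}
    (hT : E.T = E'.T + k) (ht : t < E'.T) (h : ∀ s, s < E'.T → m.mA (s + k) a = m'.mA s a) :
    Upay P E m (t + k) a = Upay P E' m' t a := by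
  have hlast : m.mA (E.T - 1) a = m'.mA (E'.T - 1) a := by
    rw [← h (E'.T - 1) (by omega)]
    congr 1
    omega
  unfold Upay
  rw [hlast]
  cases hb : m'.mA (E'.T - 1) a with
  | none => rfl
  | some b =>
    have hlast' : m'.mA (E'.T - 1) a ≠ none := by simp [hb]
    let s' := {s | t ≤ s ∧ m'.mA s a ≠ none}
    have hs' : sInf s' ∈ s' := Nat.sInf_mem ⟨E'.T - 1, by omega, hlast'⟩
    have hlt : sInf s' ≤ E'.T - 1 := Nat.sInf_le ⟨by omega, hlast'⟩
    have hinf : sInf {s | t + k ≤ s ∧ m.mA s a ≠ none} = sInf s' + k := by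
      refine IsLeast.csInf_eq ⟨⟨by have := hs'.1; omega, ?_⟩, ?_⟩
      · rw [h _ (by omega)]
        exact hs'.2
      · rintro s ⟨hs, hsa⟩
        by_contra! hlt'
        obtain ⟨r, rfl⟩ : ∃ r, s = r + k := ⟨s - k, by omega⟩
        rw [h r (by omega)] at hsa
        have : sInf s' ≤ r := Nat.sInf_le ⟨by omega, hsa⟩
        omega
    have : matchTimeA E m (t + k) a - (t + k) = matchTimeA E' m' t a - t := by
      unfold matchTimeA
      rw [hinf, hT]
      change min (sInf s' + k) _ - _ = min (sInf s') _ - _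
      omega
    rw [this]

theorem Vpay_shift {P : Pref A B} {E E' : Economy A B} {m m' : PreMatching A B} {k t : ℕ} {b : B}
    (hT : E.T = E'.T + k) (ht : t < E'.T) (h : ∀ s, s < E'.T → m.mB (s + k) b = m'.mB s b) :
    Vpay P E m (t + k) b = Vpay P E' m' t b :=
  Upay_shift (P := P.swap) (E := E.swap) (E' := E'.swap) (m := m.swap) (m' := m'.swap) hT ht h

theorem finite_Upay (P : Pref A B) (E : Economy A B) (hT : 0 < E.T) (t : ℕ) (a : A) :
    {x | ∃ m, IsMatching E m ∧ Upay P E m t a = x}.Finite := by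
  refine Set.Finite.subset (s := insert 0 (Set.image2 (fun j b => P.dA a ^ j * P.u a b)
    (Finset.range (E.T + 1) : Set ℕ) (arrBUpTo E (E.T - 1) : Set B))) ?_ ?_
  · exact ((Finset.finite_toSet _).image2 _ (Finset.finite_toSet _)).insert 0
  · rintro x ⟨m, hm, rfl⟩
    cases hb : m.mA (E.T - 1) a with
    | none => exact Or.inl (Upay_eq_zero hb)
    | some b =>
      refine Or.inr ⟨matchTimeA E m t a - t, ?_, b, hm.2.2.1 _ _ _ (by omega) hb, ?_⟩
      · have : matchTimeA E m t a ≤ E.T := min_le_right _ _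
        simp only [Finset.coe_range, Set.mem_Iio]
        omega
      · simp [Upay, hb]

theorem exists_worst_Upay (P : Pref A B) (E : Economy A B) (hT : 0 < E.T) (t : ℕ) (a : A)
    (C : Set (PreMatching A B)) (hC : ∀ m ∈ C, IsMatching E m) (hne : C.Nonempty) :
    ∃ m ∈ C, ∀ m' ∈ C, Upay P E m t a ≤ Upay P E m' t a := by
  have hfin : ((fun m => Upay P E m t a) '' C).Finite := by
    refine (finite_Upay P E hT t a).subset ?_
    rintro x ⟨m, hm, rfl⟩
    exact ⟨m, hC m hm, rfl⟩
  obtain ⟨x, ⟨m, hm, rfl⟩, hmin⟩ := Set.exists_min_image _ id hfin (hne.image _)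
  exact ⟨m, hm, fun m' hm' => hmin _ ⟨m', hm', rfl⟩⟩

theorem exists_worst_Vpay (P : Pref A B) (E : Economy A B) (hT : 0 < E.T) (t : ℕ) (b : B)
    (C : Set (PreMatching A B)) (hC : ∀ m ∈ C, IsMatching E m) (hne : C.Nonempty) :
    ∃ m ∈ C, ∀ m' ∈ C, Vpay P E m t b ≤ Vpay P E m' t b := by
  obtain ⟨-, ⟨m, hm, rfl⟩, hmin⟩ := exists_worst_Upay P.swap E.swap hT t b
    (PreMatching.swap '' C) (by rintro - ⟨m, hm, rfl⟩; exact (hC m hm).swap) (hne.image _)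
  exact ⟨m, hm, fun m' hm' => hmin _ ⟨m', hm', rfl⟩⟩

/-! ### Availability -/

theorem availA_congr {E : Economy A B} {m m' : PreMatching A B} {t : ℕ}
    (h : ∀ s, s < t → ∀ a, m.mA s a = m'.mA s a) : availA E m t = availA E m' t := by
  refine Finset.filter_congr fun a _ => ?_
  exact forall₂_congr fun s hs => by rw [h s hs a]

theorem availB_congr {E : Economy A B} {m m' : PreMatching A B} {t : ℕ}
    (h : ∀ s, s < t → ∀ b, m.mB s b = m'.mB s b) : availB E m t = availB E m' t :=
  availA_congr (E := E.swap) (m := m.swap) (m' := m'.swap) h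

theorem availA_zero (E : Economy A B) (m : PreMatching A B) : availA E m 0 = E.arrA 0 := by
  ext a
  simp [availA, arrAUpTo]

theorem availB_zero (E : Economy A B) (m : PreMatching A B) : availB E m 0 = E.arrB 0 :=
  availA_zero E.swap m.swap

theorem contEconomy_congr {E : Economy A B} {m m' : PreMatching A B} {t : ℕ}
    (h : agreeUpTo m m' t) : contEconomy E m t = contEconomy E m' t := by
  unfold contEconomy
  rw [availA_congr fun s hs => (h s hs).1, availB_congr fun s hs => (h s hs).2]

theorem mem_arrAUpTo_contEconomy_one {E : Economy A B} {m : PreMatching A B}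
    (hD : ∀ s t, s ≠ t → Disjoint (E.arrA s) (E.arrA t))
    (hm : ∀ a, m.mA 0 a ≠ none → a ∈ E.arrA 0) {t : ℕ} {a : A} :
    a ∈ arrAUpTo (contEconomy E m 1) t ↔ a ∈ arrAUpTo E (t + 1) ∧ m.mA 0 a = none := by
  simp only [arrAUpTo, Finset.mem_biUnion, Finset.mem_range, contEconomy]
  constructor
  · rintro ⟨s, hs, hsa⟩
    split_ifs at hsa with h0
    · simp only [availA, arrAUpTo, Finset.mem_filter, Finset.mem_biUnion, Finset.mem_range] at hsa
      obtain ⟨⟨r, hr, hra⟩, h⟩ := hsa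
      exact ⟨⟨r, by omega, hra⟩, h 0 one_pos⟩
    · refine ⟨⟨1 + s, by omega, hsa⟩, ?_⟩
      by_contra hne
      exact Finset.disjoint_left.1 (hD 0 (1 + s) (by omega)) (hm a hne) hsa
  · rintro ⟨⟨s, hs, hsa⟩, h⟩
    rcases Nat.lt_or_ge s 2 with hs2 | hs2
    · refine ⟨0, by omega, ?_⟩
      simp only [if_true, availA, arrAUpTo, Finset.mem_filter, Finset.mem_biUnion,
        Finset.mem_range]
      refine ⟨⟨s, hs2, hsa⟩, fun r hr => ?_⟩
      obtain rfl : r = 0 := by omega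
      exact h
    · refine ⟨s - 1, by omega, ?_⟩
      rw [if_neg (by omega)]
      rwa [show 1 + (s - 1) = s by omega]

/-! ### Extending a first-period matching -/

/-- The period-`0` component of `m` is a matching among the period-`0` arrivals of `E`. -/
structure IsInitial (E : Economy A B) (m : PreMatching A B) : Prop where
  iff : ∀ a b, m.mA 0 a = some b ↔ m.mB 0 b = some a
  memA : ∀ a, m.mA 0 a ≠ none → a ∈ E.arrA 0
  memB : ∀ b, m.mB 0 b ≠ none → b ∈ E.arrB 0

theorem IsInitial.swap {E : Economy A B} {m : PreMatching A B} (h : IsInitial E m) :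
    IsInitial E.swap m.swap :=
  ⟨fun b a => (h.iff a b).symm, h.memB, h.memA⟩

/-- Arrivals on each side are pairwise disjoint across periods. -/
structure DisjointArrivals (E : Economy A B) : Prop where
  disjA : ∀ s t, s ≠ t → Disjoint (E.arrA s) (E.arrA t)
  disjB : ∀ s t, s ≠ t → Disjoint (E.arrB s) (E.arrB t)

theorem DisjointArrivals.swap {E : Economy A B} (h : DisjointArrivals E) :
    DisjointArrivals E.swap :=
  ⟨h.disjB, h.disjA⟩

theorem disjoint_arrA_contEconomy {E : Economy A B}
    (h : ∀ s t, s ≠ t → Disjoint (E.arrA s) (E.arrA t)) (m : PreMatching A B) (r : ℕ) :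
    ∀ s t, s ≠ t → Disjoint ((contEconomy E m r).arrA s) ((contEconomy E m r).arrA t) := by
  have key : ∀ s, s ≠ 0 → Disjoint (availA E m r) (E.arrA (r + s)) := by
    intro s hs
    refine Finset.disjoint_left.2 fun a ha ha' => ?_
    simp only [availA, arrAUpTo, Finset.mem_filter, Finset.mem_biUnion, Finset.mem_range] at ha
    obtain ⟨⟨q, hq, hqa⟩, -⟩ := ha
    exact Finset.disjoint_left.1 (h q (r + s) (by omega)) hqa ha'
  intro s t hst
  simp only [contEconomy]
  split_ifs with hs ht ht
  · omega
  · exact key t ht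
  · exact (key s hs).symm
  · exact h _ _ (by omega)

theorem DisjointArrivals.contEconomy {E : Economy A B} (h : DisjointArrivals E)
    (m : PreMatching A B) (t : ℕ) : DisjointArrivals (contEconomy E m t) :=
  ⟨disjoint_arrA_contEconomy h.disjA m t,
    disjoint_arrA_contEconomy (E := E.swap) h.disjB m.swap t⟩

theorem splice_mA_zero (m m' : PreMatching A B) (a : A) :
    (splice m m' 1).mA 0 a = m.mA 0 a := by
  simp [splice]

theorem splice_mB_zero (m m' : PreMatching A B) (b : B) :
    (splice m m' 1).mB 0 b = m.mB 0 b := by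
  simp [splice]

theorem splice_mA_succ (m m' : PreMatching A B) (s : ℕ) (a : A) :
    (splice m m' 1).mA (s + 1) a = if m.mA 0 a = none then m'.mA s a else m.mA 0 a := by
  simp [splice]

theorem splice_mB_succ (m m' : PreMatching A B) (s : ℕ) (b : B) :
    (splice m m' 1).mB (s + 1) b = if m.mB 0 b = none then m'.mB s b else m.mB 0 b := by
  simp [splice]

theorem splice_swap (m m' : PreMatching A B) (t : ℕ) :
    (splice m m' t).swap = splice m.swap m'.swap t := rfl

theorem mA_zero_eq_none_of_continuation {E : Economy A B} {m m' : PreMatching A B}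
    (hD : DisjointArrivals E) (hm : IsInitial E m) (hm' : IsMatching (contEconomy E m 1) m')
    {s : ℕ} (hs : s < (contEconomy E m 1).T) {a : A} (ha : m'.mA s a ≠ none) :
    m.mA 0 a = none :=
  ((mem_arrAUpTo_contEconomy_one hD.disjA hm.memA).1 (hm'.2.1 s a hs ha)).2

theorem mB_zero_eq_none_of_continuation {E : Economy A B} {m m' : PreMatching A B}
    (hD : DisjointArrivals E) (hm : IsInitial E m) (hm' : IsMatching (contEconomy E m 1) m')
    {s : ℕ} (hs : s < (contEconomy E m 1).T) {b : B} (hb : m'.mB s b ≠ none) :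
    m.mB 0 b = none :=
  mA_zero_eq_none_of_continuation (E := E.swap) (m := m.swap) (m' := m'.swap) hD.swap hm.swap
    hm'.swap hs hb

theorem splice_mA_stays {E : Economy A B} {m m' : PreMatching A B}
    (hm' : IsMatching (contEconomy E m 1) m') (t s : ℕ) (a : A) (hts : t ≤ s) (hs : s < E.T)
    (h : (splice m m' 1).mA t a ≠ none) :
    (splice m m' 1).mA s a = (splice m m' 1).mA t a := by
  have hT : (contEconomy E m 1).T = E.T - 1 := rfl
  rcases t with _ | t <;> rcases s with _ | s
  · rfl
  · rw [splice_mA_zero] at h ⊢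
    rw [splice_mA_succ, if_neg h]
  · omega
  · rw [splice_mA_succ] at h ⊢
    rw [splice_mA_succ]
    split_ifs at h ⊢
    · exact hm'.2.2.2.1 t s a (by omega) (by omega) h
    · rfl

theorem mem_arrAUpTo_of_splice {E : Economy A B} {m m' : PreMatching A B}
    (hD : DisjointArrivals E) (hm : IsInitial E m) (hm' : IsMatching (contEconomy E m 1) m')
    (t : ℕ) (a : A) (ht : t < E.T) (h : (splice m m' 1).mA t a ≠ none) : a ∈ arrAUpTo E t := by
  have hT : (contEconomy E m 1).T = E.T - 1 := rfl
  rcases t with _ | t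
  · rw [splice_mA_zero] at h
    exact Finset.mem_biUnion.2 ⟨0, by simp, hm.memA a h⟩
  · rw [splice_mA_succ] at h
    split_ifs at h with h0
    · exact ((mem_arrAUpTo_contEconomy_one hD.disjA hm.memA).1
        (hm'.2.1 t a (by omega) h)).1
    · exact Finset.mem_biUnion.2 ⟨0, by simp, hm.memA a h⟩

theorem isMatching_splice {E : Economy A B} {m m' : PreMatching A B}
    (hD : DisjointArrivals E) (hm : IsInitial E m) (hm' : IsMatching (contEconomy E m 1) m') :
    IsMatching E (splice m m' 1) := by
  have hT : (contEconomy E m 1).T = E.T - 1 := rfl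
  have hiff : ∀ t a b, t < E.T →
      ((splice m m' 1).mA t a = some b ↔ (splice m m' 1).mB t b = some a) := by
    rintro (_ | t) a b ht
    · rw [splice_mA_zero, splice_mB_zero, hm.iff]
    · rw [splice_mA_succ, splice_mB_succ]
      have h1 := hm'.1 t a b (by omega)
      have h2 := hm.iff a b
      have h3 := mA_zero_eq_none_of_continuation hD hm hm' (s := t) (by omega) (a := a)
      have h4 := mB_zero_eq_none_of_continuation hD hm hm' (s := t) (by omega) (b := b)
      split_ifs with ha hb hb
      · exact h1
      · refine ⟨fun h => absurd (h4 (by simp [h1.1 h])) hb, fun h => ?_⟩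
        rw [h2.2 h] at ha
        simp at ha
      · refine ⟨fun h => ?_, fun h => absurd (h3 (by simp [h1.2 h])) ha⟩
        rw [h2.1 h] at hb
        simp at hb
      · exact h2
  refine ⟨hiff, mem_arrAUpTo_of_splice hD hm hm', fun t a b ht h => ?_,
    splice_mA_stays hm', ?_⟩
  · refine mem_arrAUpTo_of_splice (E := E.swap) (m := m.swap) (m' := m'.swap) hD.swap hm.swap
      hm'.swap t b ht ?_
    rw [← splice_swap]
    change (splice m m' 1).mB t b ≠ none
    simp [(hiff t a b ht).1 h]
  · exact splice_mA_stays (E := E.swap) (m := m.swap) (m' := m'.swap) hm'.swap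

theorem availA_splice {E : Economy A B} {m m' : PreMatching A B}
    (hD : ∀ s t, s ≠ t → Disjoint (E.arrA s) (E.arrA t))
    (hm : ∀ a, m.mA 0 a ≠ none → a ∈ E.arrA 0) (t : ℕ) :
    availA E (splice m m' 1) (t + 1) = availA (contEconomy E m 1) m' t := by
  ext a
  simp only [availA, Finset.mem_filter, mem_arrAUpTo_contEconomy_one hD hm, and_assoc]
  refine and_congr_right fun _ => ⟨fun h => ?_, ?_⟩
  · have h0 : m.mA 0 a = none := by simpa [splice_mA_zero] using h 0 (by omega)
    exact ⟨h0, fun s hs => by simpa [splice_mA_succ, h0] using h (s + 1) (by omega)⟩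
  · rintro ⟨h0, h⟩ (_ | s) hs
    · rw [splice_mA_zero, h0]
    · rw [splice_mA_succ, if_pos h0, h s (by omega)]

theorem availB_splice {E : Economy A B} {m m' : PreMatching A B}
    (hD : ∀ s t, s ≠ t → Disjoint (E.arrB s) (E.arrB t))
    (hm : ∀ b, m.mB 0 b ≠ none → b ∈ E.arrB 0) (t : ℕ) :
    availB E (splice m m' 1) (t + 1) = availB (contEconomy E m 1) m' t :=
  availA_splice (E := E.swap) (m := m.swap) (m' := m'.swap) hD hm t

theorem contEconomy_splice_one (E : Economy A B) (m m' : PreMatching A B) :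
    contEconomy E (splice m m' 1) 1 = contEconomy E m 1 := by
  refine contEconomy_congr fun s hs => ?_
  obtain rfl : s = 0 := by omega
  exact ⟨splice_mA_zero m m', splice_mB_zero m m'⟩

theorem contEconomy_splice {E : Economy A B} {m m' : PreMatching A B}
    (hD : DisjointArrivals E) (hm : IsInitial E m) (t : ℕ) :
    contEconomy E (splice m m' 1) (t + 2) = contEconomy (contEconomy E m 1) m' (t + 1) := by
  rw [contEconomy, contEconomy, availA_splice hD.disjA hm.memA, availB_splice hD.disjB hm.memB]
  congr 1
  · change E.T - (t + 2) = E.T - 1 - (t + 1)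
    omega
  · funext s
    split_ifs with hs
    · rfl
    · simp only [contEconomy]
      rw [if_neg (by omega)]
      congr 1
      omega
  · funext s
    split_ifs with hs
    · rfl
    · simp only [contEconomy]
      rw [if_neg (by omega)]
      congr 1
      omega

/-- Restricting a spliced matching recovers the restricted continuation within the horizon. -/
theorem restrictM_splice_mA {E : Economy A B} {m m' : PreMatching A B}
    (hD : DisjointArrivals E) (hm : IsInitial E m) (hm' : IsMatching (contEconomy E m 1) m')
    (t s : ℕ) (hs : t + s < (contEconomy E m 1).T) (a : A) :
    (restrictM (splice m m' 1) (t + 1)).mA s a = (restrictM m' t).mA s a := by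
  have hshift : t + 1 + s = t + s + 1 := by omega
  by_cases h0 : m.mA 0 a = none
  · have hiff : (∀ r, r < t + 1 → (splice m m' 1).mA r a = none) ↔
        ∀ r, r < t → m'.mA r a = none := by
      refine ⟨fun h r hr => by simpa [splice_mA_succ, h0] using h (r + 1) (by omega), ?_⟩
      rintro h (_ | r) hr
      · rw [splice_mA_zero, h0]
      · rw [splice_mA_succ, if_pos h0, h r (by omega)]
    simp only [restrictM, hiff, hshift, splice_mA_succ, h0, if_true]
  · have hnone : m'.mA (t + s) a = none := by
      by_contra hne
      exact h0 (mA_zero_eq_none_of_continuation hD hm hm' hs hne)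
    have hnot : ¬ ∀ r, r < t + 1 → (splice m m' 1).mA r a = none := fun h =>
      h0 (by simpa [splice_mA_zero] using h 0 (by omega))
    simp only [restrictM, hnot, if_false, hnone, ite_self]

theorem agreeUpTo_restrictM_splice {E : Economy A B} {m m' : PreMatching A B}
    (hD : DisjointArrivals E) (hm : IsInitial E m) (hm' : IsMatching (contEconomy E m 1) m')
    (t : ℕ) : agreeUpTo (restrictM m' t) (restrictM (splice m m' 1) (t + 1))
      ((contEconomy E m 1).T - t) := fun s hs =>
  ⟨fun a => (restrictM_splice_mA hD hm hm' t s (by omega) a).symm,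
    fun b => (restrictM_splice_mA (E := E.swap) (m := m.swap) (m' := m'.swap) hD.swap hm.swap
      hm'.swap t s (Nat.add_lt_of_lt_sub' hs) b).symm⟩

/-! ### The solution correspondence -/

theorem IsMatching.congr {E : Economy A B} {m m' : PreMatching A B} (hm : IsMatching E m)
    (h : agreeUpTo m m' E.T) : IsMatching E m' := by
  obtain ⟨h1, h2, h3, h4, h5⟩ := hm
  refine ⟨fun t a b ht => ?_, fun t a ht => ?_, fun t a b ht => ?_, fun t s a hts hs => ?_,
    fun t s b hts hs => ?_⟩
  · rw [← (h t ht).1, ← (h t ht).2]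
    exact h1 t a b ht
  · rw [← (h t ht).1]
    exact h2 t a ht
  · rw [← (h t ht).1]
    exact h3 t a b ht
  · rw [← (h s hs).1, ← (h t (by omega)).1]
    exact h4 t s a hts hs
  · rw [← (h s hs).2, ← (h t (by omega)).2]
    exact h5 t s b hts hs

theorem starConj_congr (S : Economy A B → Set (PreMatching A B)) (E : Economy A B)
    {m m' : PreMatching A B} {t : ℕ} (h : agreeUpTo m m' t) (k : Agent A B) :
    starConj S E t m k = starConj S E t m' k := by
  have : ∀ n, agreeUpTo m n t ↔ agreeUpTo m' n t := fun n =>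
    forall₂_congr fun s hs => by simp only [(h s hs).1, (h s hs).2]
  simp only [starConj, MSet, this]

theorem IsSolution.congr {P : Pref A B} {S : Economy A B → Set (PreMatching A B)}
    {E : Economy A B} {m m' : PreMatching A B} (hm : IsSolution P E (starConj S E) m)
    (h : agreeUpTo m m' E.T) : IsSolution P E (starConj S E) m' := by
  refine ⟨hm.1.congr h, fun t ht => ?_⟩
  have hU : ∀ a, Upay P E m' t a = Upay P E m t a := fun a =>
    Upay_shift (k := 0) rfl ht fun s hs => ((h s hs).1 a).symm
  have hV : ∀ b, Vpay P E m' t b = Vpay P E m t b := fun b =>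
    Vpay_shift (k := 0) rfl ht fun s hs => ((h s hs).2 b).symm
  have ht' : agreeUpTo m m' t := fun s hs => h s (hs.trans ht)
  have := hm.2 t ht
  simp only [starConj_congr S E ht', availA_congr fun s hs => (ht' s hs).1,
    availB_congr fun s hs => (ht' s hs).2] at this
  simpa only [hU, hV] using this

theorem isMatching_emptyM (E : Economy A B) : IsMatching E (emptyM : PreMatching A B) := by
  refine ⟨?_, ?_, ?_, ?_, ?_⟩ <;> simp [emptyM]

theorem isInitial_emptyM (E : Economy A B) : IsInitial E (emptyM : PreMatching A B) := by
  refine ⟨?_, ?_, ?_⟩ <;> simp [emptyM]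

theorem stable1_iff_isSolution {P : Pref A B} {S : Economy A B → Set (PreMatching A B)}
    (hS : IsStarFamily P S) {E : Economy A B} (hT : E.T = 1) (m : PreMatching A B) :
    Stable1 P E m ↔ IsSolution P E (starConj S E) m := by
  have hT0 : 0 < E.T := by omega
  have hlast : E.T - 1 = 0 := by omega
  have hempty : ∀ k, (emptyM : PreMatching A B) ∈ starConj S E 0 m k := by
    intro k
    refine ⟨⟨isMatching_emptyM E, fun s hs => absurd hs (by omega), ?_⟩, ?_⟩
    · rcases k with a | b <;> intro s hs <;> rfl
    · rw [hS.1 _ (by simp [contEconomy, hT])]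
      exact Set.mem_univ _
  constructor
  · rintro ⟨hm, hA, hB, hst⟩
    rw [hlast] at hA hB
    refine ⟨hm, fun t ht => ?_⟩
    obtain rfl : t = 0 := by omega
    rw [availA_zero, availB_zero]
    refine ⟨fun a _ => ⟨emptyM, hempty _, ?_⟩, fun b _ => ⟨emptyM, hempty _, ?_⟩, hst⟩
    · rw [Upay_eq_zero (m := emptyM) rfl]
      cases hb : m.mA 0 a with
      | none => rw [Upay_eq_zero (by rw [hlast, hb])]
      | some b => exact (Upay_of_matched (P := P) hm hT0 hb).symm ▸ hA a b hb
    · rw [Vpay_eq_zero (m := emptyM) rfl]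
      cases ha : m.mB 0 b with
      | none => rw [Vpay_eq_zero (by rw [hlast, ha])]
      | some a => exact (Vpay_of_matched (P := P) hm hT0 ha).symm ▸ hB b a ha
  · rintro ⟨hm, hsol⟩
    have := hsol 0 hT0
    rw [availA_zero, availB_zero] at this
    obtain ⟨hA, hB, hst⟩ := this
    refine ⟨hm, fun a b hab => ?_, fun b a hba => ?_, hst⟩
    · rw [hlast] at hab
      have ha : a ∈ E.arrA 0 := by simpa [arrAUpTo] using hm.2.1 0 a hT0 (by simp [hab])
      obtain ⟨m', hm', hle⟩ := hA a ha
      rw [Upay_of_matched hm hT0 hab,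
        Upay_eq_zero (by rw [hlast]; exact hm'.1.2.2 0 le_rfl)] at hle
      exact hle
    · rw [hlast] at hba
      have hb : b ∈ E.arrB 0 := by
        simpa [arrBUpTo] using hm.2.2.1 0 a b hT0 ((hm.1 0 a b hT0).2 hba)
      obtain ⟨m', hm', hle⟩ := hB b hb
      rw [Vpay_of_matched hm hT0 hba,
        Vpay_eq_zero (by rw [hlast]; exact hm'.1.2.2 0 le_rfl)] at hle
      exact hle

theorem IsStarFamily.mem_iff {P : Pref A B} {S : Economy A B → Set (PreMatching A B)}
    (hS : IsStarFamily P S) {E : Economy A B} (hT : 0 < E.T) (m : PreMatching A B) :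
    m ∈ S E ↔ IsSolution P E (starConj S E) m := by
  rcases Nat.lt_or_ge E.T 2 with h | h
  · rw [hS.2.1 E (by omega)]
    exact stable1_iff_isSolution hS (by omega) m
  · rw [hS.2.2 E h]
    rfl

theorem IsStarFamily.mem_congr {P : Pref A B} {S : Economy A B → Set (PreMatching A B)}
    (hS : IsStarFamily P S) {E : Economy A B} {m m' : PreMatching A B} (hm : m ∈ S E)
    (h : agreeUpTo m m' E.T) : m' ∈ S E := by
  rcases Nat.eq_zero_or_pos E.T with h0 | h0
  · rw [hS.1 E h0]
    exact Set.mem_univ _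
  · rw [hS.mem_iff h0] at hm ⊢
    exact hm.congr h

theorem IsStarFamily.isMatching {P : Pref A B} {S : Economy A B → Set (PreMatching A B)}
    (hS : IsStarFamily P S) {E : Economy A B} {m : PreMatching A B} (hm : m ∈ S E) :
    IsMatching E m := by
  rcases Nat.eq_zero_or_pos E.T with h0 | h0
  · refine ⟨?_, ?_, ?_, ?_, ?_⟩ <;> intros <;> omega
  · exact ((hS.mem_iff h0 m).1 hm).1

/-- A first-period matching followed by a solution of the continuation economy is conjectured
by every agent left unmatched in the first period. -/
theorem splice_mem_starConj_zero {P : Pref A B} {S : Economy A B → Set (PreMatching A B)}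
    (hS : IsStarFamily P S) {E : Economy A B} {m m' : PreMatching A B} (hD : DisjointArrivals E)
    (hm : IsInitial E m) (hm' : m' ∈ S (contEconomy E m 1)) (n : PreMatching A B)
    {k : Agent A B} (hk : unmatchedAt m 0 k) : splice m m' 1 ∈ starConj S E 0 n k := by
  have hmat := hS.isMatching hm'
  refine ⟨⟨isMatching_splice hD hm hmat, fun s hs => absurd hs (by omega), ?_⟩, ?_⟩
  · rcases k with a | b <;> intro s hs <;> obtain rfl : s = 0 := by omega
    · rw [splice_mA_zero]
      exact hk
    · rw [splice_mB_zero]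
      exact hk
  · rw [Nat.zero_add, contEconomy_splice_one]
    refine hS.mem_congr hm' ?_
    have h := agreeUpTo_restrictM_splice hD hm hmat 0
    have h0 : restrictM m' 0 = m' := by simp [restrictM]
    rwa [h0] at h

/-- Conjectures in the continuation economy extend to conjectures in the original economy. -/
theorem splice_mem_starConj_succ {P : Pref A B} {S : Economy A B → Set (PreMatching A B)}
    (hS : IsStarFamily P S) {E : Economy A B} {m m' n : PreMatching A B}
    (hD : DisjointArrivals E) (hm : IsInitial E m) {t : ℕ} {k : Agent A B}
    (hn : n ∈ starConj S (contEconomy E m 1) t m' k) (hk : unmatchedAt m 0 k) :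
    splice m n 1 ∈ starConj S E (t + 1) (splice m m' 1) k := by
  obtain ⟨⟨hmat, hagree, hun⟩, hcont⟩ := hn
  refine ⟨⟨isMatching_splice hD hm hmat, ?_, ?_⟩, ?_⟩
  · rintro (_ | s) hs
    · simp only [splice_mA_zero, splice_mB_zero, implies_true, and_self]
    · have := hagree s (by omega)
      simp only [splice_mA_succ, splice_mB_succ, this.1, this.2, implies_true, and_self]
  · rcases k with a | b <;> rintro (_ | s) hs
    · rw [splice_mA_zero]
      exact hk
    · rw [splice_mA_succ, if_pos (show m.mA 0 a = none from hk)]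
      exact hun s (by omega)
    · rw [splice_mB_zero]
      exact hk
    · rw [splice_mB_succ, if_pos (show m.mB 0 b = none from hk)]
      exact hun s (by omega)
  · rw [contEconomy_splice hD hm]
    exact hS.mem_congr hcont (agreeUpTo_restrictM_splice hD hm hmat (t + 1))

theorem IsStarFamily.nonempty {P : Pref A B} {S : Economy A B → Set (PreMatching A B)}
    (hS : IsStarFamily P S) (n : ℕ) :
    ∀ E : Economy A B, E.T = n → DisjointArrivals E → (S E).Nonempty := by
  induction n with
  | zero =>
    intro E hT _
    rw [hS.1 E hT]
    exact ⟨emptyM, Set.mem_univ _⟩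
  | succ n ih =>
    intro E hT hD
    have hT0 : 0 < E.T := by omega
    have hcont : ∀ m, (S (contEconomy E m 1)).Nonempty := fun m =>
      ih _ (by simp [contEconomy, hT]) (hD.contEconomy m 1)
    have hconj : ∀ k, (starConj S E 0 emptyM k).Nonempty := by
      intro k
      obtain ⟨m', hm'⟩ := hcont emptyM
      refine ⟨_, splice_mem_starConj_zero hS hD (isInitial_emptyM E) hm' emptyM ?_⟩
      rcases k with a | b <;> rfl
    choose wa hwa hwa_le using fun a => exists_worst_Upay P E hT0 0 a _
      (fun m hm => hm.1.1) (hconj (Sum.inl a))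
    choose wb hwb hwb_le using fun b => exists_worst_Vpay P E hT0 0 b _
      (fun m hm => hm.1.1) (hconj (Sum.inr b))
    obtain ⟨M, hM, hstable⟩ := exists_stable_pairing (E.arrA 0) (E.arrB 0) P.u P.v
      (fun a => Upay P E (wa a) 0 a) (fun b => Vpay P E (wb b) 0 b)
    have hMA : ∀ {t a b}, (ofPairs M).mA t a = some b ↔ (a, b) ∈ M :=
      ofPairs_mA_eq_some hM.right_unique
    have hMB : ∀ {t a b}, (ofPairs M).mB t b = some a ↔ (a, b) ∈ M :=
      ofPairs_mB_eq_some hM.left_unique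
    have hinit : IsInitial E (ofPairs M) := by
      refine ⟨fun a b => by rw [hMA, hMB], fun a ha => ?_, fun b hb => ?_⟩
      · obtain ⟨b, hb⟩ := Option.ne_none_iff_exists'.1 ha
        exact (Finset.mem_product.1 (hM.subset (hMA.1 hb))).1
      · obtain ⟨a, ha⟩ := Option.ne_none_iff_exists'.1 hb
        exact (Finset.mem_product.1 (hM.subset (hMB.1 ha))).2
    obtain ⟨m', hm'⟩ := hcont (ofPairs M)
    have hmat := isMatching_splice hD hinit (hS.isMatching hm')
    set c := splice (ofPairs M) m' 1 with hc
    have hU : ∀ {a b}, (a, b) ∈ M → Upay P E c 0 a = P.u a b := fun h =>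
      Upay_of_matched hmat hT0 (by rw [hc, splice_mA_zero, hMA.2 h])
    have hV : ∀ {a b}, (a, b) ∈ M → Vpay P E c 0 b = P.v a b := fun h =>
      Vpay_of_matched hmat hT0 (by rw [hc, splice_mB_zero, hMB.2 h])
    have hUge : ∀ a, Upay P E (wa a) 0 a ≤ Upay P E c 0 a := by
      intro a
      cases h : (ofPairs M).mA 0 a with
      | none => exact hwa_le a c (splice_mem_starConj_zero hS hD hinit hm' _ h)
      | some b =>
        rw [hU (hMA.1 h)]
        exact (hM.rational a b (hMA.1 h)).1
    have hVge : ∀ b, Vpay P E (wb b) 0 b ≤ Vpay P E c 0 b := by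
      intro b
      cases h : (ofPairs M).mB 0 b with
      | none => exact hwb_le b c (splice_mem_starConj_zero hS hD hinit hm' _ h)
      | some a =>
        rw [hV (hMB.1 h)]
        exact (hM.rational a b (hMB.1 h)).2
    refine ⟨c, (hS.mem_iff hT0 c).2 ⟨hmat, ?_⟩⟩
    rintro (_ | t) ht
    · have hzero : agreeUpTo c emptyM 0 := fun s hs => absurd hs (by omega)
      rw [availA_zero, availB_zero]
      refine ⟨fun a _ => ⟨wa a, ?_, hUge a⟩, fun b _ => ⟨wb b, ?_, hVge b⟩, ?_⟩
      · rw [starConj_congr S E hzero]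
        exact hwa a
      · rw [starConj_congr S E hzero]
        exact hwb b
      · rintro a ha b hb ⟨hu, hv⟩
        refine hstable a ha b hb ⟨(hUge a).trans_lt hu, (hVge b).trans_lt hv,
          fun b' hb' => ?_, fun a' ha' => ?_⟩
        · rwa [← hU hb']
        · rwa [← hV ha']
    · have hT' : E.T = (contEconomy E (ofPairs M) 1).T + 1 := by
        change E.T = E.T - 1 + 1
        omega
      have ht' : t < (contEconomy E (ofPairs M) 1).T := by omega
      have hpayA : ∀ {a}, a ∈ availA E c (t + 1) → (ofPairs M).mA 0 a = none ∧
          ∀ q, Upay P E (splice (ofPairs M) q 1) (t + 1) a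
            = Upay P (contEconomy E (ofPairs M) 1) q t a := by
        intro a ha
        have h0 : (ofPairs M).mA 0 a = none := by
          simpa [hc, splice_mA_zero] using (Finset.mem_filter.1 ha).2 0 (by omega)
        exact ⟨h0, fun q => Upay_shift hT' ht' fun s _ => by rw [splice_mA_succ, if_pos h0]⟩
      have hpayB : ∀ {b}, b ∈ availB E c (t + 1) → (ofPairs M).mB 0 b = none ∧
          ∀ q, Vpay P E (splice (ofPairs M) q 1) (t + 1) b
            = Vpay P (contEconomy E (ofPairs M) 1) q t b := by
        intro b hb
        have h0 : (ofPairs M).mB 0 b = none := by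
          simpa [hc, splice_mB_zero] using (Finset.mem_filter.1 hb).2 0 (by omega)
        exact ⟨h0, fun q => Vpay_shift hT' ht' fun s _ => by rw [splice_mB_succ, if_pos h0]⟩
      obtain ⟨hA, hB, hst⟩ := ((hS.mem_iff (by omega) m').1 hm').2 t ht'
      rw [← availA_splice hD.disjA hinit.memA] at hA hst
      rw [← availB_splice hD.disjB hinit.memB] at hB hst
      refine ⟨fun a ha => ?_, fun b hb => ?_, fun a ha b hb => ?_⟩
      · obtain ⟨q, hq, hle⟩ := hA a ha
        obtain ⟨h0, hpay⟩ := hpayA ha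
        refine ⟨_, splice_mem_starConj_succ hS hD hinit hq h0, ?_⟩
        rwa [hc, hpay, hpay]
      · obtain ⟨q, hq, hle⟩ := hB b hb
        obtain ⟨h0, hpay⟩ := hpayB hb
        refine ⟨_, splice_mem_starConj_succ hS hD hinit hq h0, ?_⟩
        rwa [hc, hpay, hpay]
      · rw [hc, (hpayA ha).2, (hpayB hb).2]
        exact hst a ha b hb

/-- Corollary 1: the solution correspondence `Σ*` recursively defined by
the conjectures `φ*` (agents only rule out continuation matchings that do not conform
with the solution concept from tomorrow onward) is nonempty-valued on every economy. -/
theorem statement5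
    (A B : Type) [DecidableEq A] [DecidableEq B]
    (P : Pref A B) (hP : P.Valid)
    (S : Economy A B → Set (PreMatching A B)) (hS : IsStarFamily P S)
    (E : Economy A B) (hE : E.Valid) :
    (S E).Nonempty := by
  exact hS.nonempty E.T E rfl ⟨hE.2.1, hE.2.2.1⟩

end

end DynMatch
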